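/- arXiv:2102.01071 — 2 statements merged into one kernel-verified Lean document; each statement's English description precedes it below -/
import Mathlib

section
/- Let i, j, k be pairwise distinct vertices of G such that ⟨ij⟩ and ⟨ik⟩ are both edges of G. Then: (1) if d_kj(G − ⟨ij⟩) ≤ 2 (in particular, if k is adjacent to j), then α_ik(G) = α_ik(G − ⟨ij⟩); (2) if d_kj(G − ⟨ij⟩) > 2 (including the case d_kj(G − ⟨ij⟩) = ∞), then α_ik(G) < α_ik(G − ⟨ij⟩). -/
open Finset
open scoped Classical

variable {V : Type*} [Fintype V] [DecidableEq V]

/-- Harmonic centrality (closeness) of `u` in `G`:  `Φ_u(G) = ∑_{v ≠ u} 1/d_uv(G)`,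
with the convention `1/∞ = 0` (Mathlib's `SimpleGraph.dist` is `0` on unreachable pairs,
and `(0 : ℝ)⁻¹ = 0`). -/
noncomputable def Phi (G : SimpleGraph V) (u : V) : ℝ :=
  ∑ v ∈ Finset.univ.filter (· ≠ u), ((G.dist u v : ℝ))⁻¹

/-- Local resource availability of `u` from `v` in `G`:
`α_uv(G) = p(1−q)/(d_uv(G)·Φ_v(G))` when `u` and `v` are connected in `G`, else `0`. -/
noncomputable def alpha (p q : ℝ) (G : SimpleGraph V) (u v : V) : ℝ :=
  if G.Reachable u v then p * (1 - q) / ((G.dist u v : ℝ) * Phi G v) else 0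

theorem inv_dist_anti {W : Type*} {G H : SimpleGraph W} (h : H ≤ G) (u v : W) :
    ((H.dist u v : ℝ))⁻¹ ≤ ((G.dist u v : ℝ))⁻¹ := by
  by_cases hr : H.Reachable u v
  · by_cases huv : u = v
    · simp [huv]
    · have hpos : 0 < G.dist u v := (hr.mono h).pos_dist_of_ne huv
      gcongr
  · rw [SimpleGraph.dist_eq_zero_of_not_reachable hr]
    simp

theorem inv_dist_lt_inv_dist_of_edist_lt {W : Type*} {G H : SimpleGraph W} {u v : W}
    (huv : u ≠ v) (h : G.edist u v < H.edist u v) :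
    ((H.dist u v : ℝ))⁻¹ < ((G.dist u v : ℝ))⁻¹ := by
  have hG : G.Reachable u v := SimpleGraph.reachable_of_edist_ne_top h.ne_top
  have hpos : 0 < G.dist u v := hG.pos_dist_of_ne huv
  by_cases hH : H.Reachable u v
  · rw [← hG.coe_dist_eq_edist, ← hH.coe_dist_eq_edist] at h
    have h' : G.dist u v < H.dist u v := by exact_mod_cast h
    gcongr
  · rw [SimpleGraph.dist_eq_zero_of_not_reachable hH]
    simpa using hpos

/-- If every edge of `G` changes the distance to `k` in `H` by at most one, then distances to `k`
in `H` are at most those in `G`. -/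
theorem edist_le_edist_of_adj {W : Type*} {G H : SimpleGraph W} {k : W}
    (h : ∀ a b, G.Adj a b → H.edist k b ≤ H.edist k a + 1) (v : W) :
    H.edist k v ≤ G.edist k v := by
  have walk_bound : ∀ a b (w : G.Walk a b), H.edist k b ≤ H.edist k a + w.length := by
    intro a b w
    induction w with
    | nil => simp
    | cons hab w ih =>
      refine ih.trans ((add_le_add_left (h _ _ hab) _).trans_eq ?_)
      rw [SimpleGraph.Walk.length_cons, Nat.cast_add, Nat.cast_one, add_assoc, add_comm 1]
  by_cases hr : G.Reachable k v
  · obtain ⟨w, hw⟩ := hr.exists_walk_length_eq_edist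
    simpa [← hw] using walk_bound k v w
  · simp [SimpleGraph.edist_eq_top_of_not_reachable hr]

theorem edist_deleteEdges_eq_of_edist_le_two {W : Type*} {G : SimpleGraph W} {i j k : W}
    (hki : (G.deleteEdges {s(i, j)}).Adj k i)
    (hkj : (G.deleteEdges {s(i, j)}).edist k j ≤ 2) (v : W) :
    (G.deleteEdges {s(i, j)}).edist k v = G.edist k v := by
  refine le_antisymm (edist_le_edist_of_adj (fun a b hab => ?_) v)
    (SimpleGraph.edist_anti (G.deleteEdges_le _))
  have hi : (G.deleteEdges {s(i, j)}).edist k i = 1 := SimpleGraph.edist_eq_one_iff_adj.2 hki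
  by_cases he : s(a, b) = s(i, j)
  · rcases Sym2.eq_iff.1 he with ⟨rfl, rfl⟩ | ⟨rfl, rfl⟩
    · rw [hi, one_add_one_eq_two]
      exact hkj
    · rw [hi]
      exact le_add_self
  · have hab' : (G.deleteEdges {s(i, j)}).Adj a b := by
      rw [SimpleGraph.deleteEdges_adj]
      exact ⟨hab, he⟩
    rw [← SimpleGraph.edist_eq_one_iff_adj.2 hab']
    exact SimpleGraph.edist_triangle

theorem alpha_of_adj {W : Type*} [Fintype W] [DecidableEq W] (p q : ℝ) {G : SimpleGraph W}
    {u v : W} (h : G.Adj u v) : alpha p q G u v = p * (1 - q) / Phi G v := by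
  rw [alpha, if_pos h.reachable, SimpleGraph.dist_eq_one_iff_adj.2 h, Nat.cast_one, one_mul]

theorem Phi_pos_of_adj {W : Type*} [Fintype W] [DecidableEq W] {G : SimpleGraph W}
    {u v : W} (h : G.Adj u v) : 0 < Phi G u := by
  refine Finset.sum_pos' (fun _ _ => by positivity) ⟨v, by simp [h.ne'], ?_⟩
  simp [SimpleGraph.dist_eq_one_iff_adj.2 h]

/-- for `j, k ∈ η_i(G)`:
if `d_kj(G − ⟨ij⟩) ≤ 2` then `α_ik(G) = α_ik(G − ⟨ij⟩)`;
if `d_kj(G − ⟨ij⟩) > 2` (incl. `∞`) then `α_ik(G) < α_ik(G − ⟨ij⟩)`. -/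
theorem stmt_8 (G : SimpleGraph V) (i j k : V)
    (hij : i ≠ j) (hik : i ≠ k) (hjk : j ≠ k)
    (hije : G.Adj i j) (hike : G.Adj i k)
    (p q : ℝ) (hp0 : 0 < p) (hp1 : p < 1) (hq0 : 0 < q) (hq1 : q < 1) :
    ((G.deleteEdges {s(i, j)}).edist k j ≤ 2 →
        alpha p q G i k = alpha p q (G.deleteEdges {s(i, j)}) i k) ∧
      (2 < (G.deleteEdges {s(i, j)}).edist k j →
        alpha p q G i k < alpha p q (G.deleteEdges {s(i, j)}) i k) := by
  have hik' : (G.deleteEdges {s(i, j)}).Adj i k := by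
    rw [SimpleGraph.deleteEdges_adj]
    refine ⟨hike, fun h => ?_⟩
    rcases Sym2.eq_iff.1 h with ⟨-, h⟩ | ⟨h, -⟩
    · exact hjk h.symm
    · exact hij h
  rw [alpha_of_adj p q hike, alpha_of_adj p q hik']
  refine ⟨fun h => ?_, fun h => ?_⟩
  · simp only [Phi, SimpleGraph.dist, edist_deleteEdges_eq_of_edist_le_two hik'.symm h]
  · have hkj : G.edist k j ≤ 2 := by
      have htri := SimpleGraph.edist_triangle (G := G) (u := k) (v := i) (w := j)
      rwa [SimpleGraph.edist_eq_one_iff_adj.2 hike.symm, SimpleGraph.edist_eq_one_iff_adj.2 hije,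
        one_add_one_eq_two] at htri
    have hlt : Phi (G.deleteEdges {s(i, j)}) k < Phi G k :=
      Finset.sum_lt_sum (fun v _ => inv_dist_anti (G.deleteEdges_le _) k v)
        ⟨j, by simp [hjk], inv_dist_lt_inv_dist_of_edist_lt hjk.symm (hkj.trans_lt h)⟩
    exact div_lt_div_of_pos_left (mul_pos hp0 (sub_pos.2 hq1)) (Phi_pos_of_adj hik'.symm) hlt
end

section
/- Suppose G has diameter at most two (d_uv(G) ≤ 2 for all distinct vertices u, v) and has at least three vertices. Let i ≠ j be vertices such that ⟨ij⟩ is not an edge of G. Then for every vertex k ∉ {i, j}: Φ_k(G) = Φ_k(G + ⟨ij⟩) and γ_k(G) > γ_k(G + ⟨ij⟩); that is, every agent other than i and j experiences negative spillover when the link ⟨ij⟩ is added. -/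
open Finset
open scoped Classical

variable {V : Type*} [Fintype V] [DecidableEq V]

/-- Global resource availability of `u` in `G`: `γ_u(G) = 1 − Π_{v ≠ u}(1 − α_uv(G))`. -/
noncomputable def gammaRA (p q : ℝ) (G : SimpleGraph V) (u : V) : ℝ :=
  1 - ∏ v ∈ Finset.univ.filter (· ≠ u), (1 - alpha p q G u v)

omit [Fintype V] [DecidableEq V] in
/-- In a graph of diameter at most two, any two vertices are reachable from each other. -/
theorem reachable_of_edist_le_two {G : SimpleGraph V}
    (h : ∀ u v : V, u ≠ v → G.edist u v ≤ 2) (u v : V) : G.Reachable u v := by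
  rcases eq_or_ne u v with rfl | huv
  · exact SimpleGraph.Reachable.refl _
  · refine SimpleGraph.edist_ne_top_iff_reachable.mp fun htop => ?_
    have h2 := h u v huv
    rw [htop] at h2
    exact absurd h2 (by decide)

omit [Fintype V] [DecidableEq V] in
/-- In a graph of diameter at most two, the distance is determined by adjacency. -/
theorem dist_eq_ite_of_edist_le_two {G : SimpleGraph V}
    (h : ∀ u v : V, u ≠ v → G.edist u v ≤ 2) {u v : V} (huv : u ≠ v) :
    G.dist u v = if G.Adj u v then 1 else 2 := by
  have hr := reachable_of_edist_le_two h u v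
  split_ifs with hadj
  · exact SimpleGraph.dist_eq_one_iff_adj.mpr hadj
  · have hne : G.dist u v ≠ 1 := fun h1 => hadj (SimpleGraph.dist_eq_one_iff_adj.mp h1)
    have hpos : 0 < G.dist u v := hr.pos_dist_of_ne huv
    have hle : G.dist u v ≤ 2 := by
      have h2 := h u v huv
      rw [← hr.coe_dist_eq_edist] at h2
      exact_mod_cast h2
    omega

omit [Fintype V] [DecidableEq V] in
theorem inv_dist_le_inv_dist_of_le {G H : SimpleGraph V}
    (hG : ∀ u v : V, u ≠ v → G.edist u v ≤ 2) (hGH : G ≤ H) {u v : V} (huv : u ≠ v) :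
    ((G.dist u v : ℝ))⁻¹ ≤ ((H.dist u v : ℝ))⁻¹ := by
  have hr := reachable_of_edist_le_two hG u v
  have hpos : (0 : ℝ) < H.dist u v := by exact_mod_cast (hr.mono hGH).pos_dist_of_ne huv
  exact inv_anti₀ hpos (by exact_mod_cast hr.dist_anti hGH)

theorem Phi_mono {G H : SimpleGraph V} (hG : ∀ u v : V, u ≠ v → G.edist u v ≤ 2)
    (hGH : G ≤ H) (u : V) : Phi G u ≤ Phi H u :=
  Finset.sum_le_sum fun _ hv =>
    inv_dist_le_inv_dist_of_le hG hGH (Finset.mem_filter.mp hv).2.symm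

/-- A new neighbour strictly increases closeness in a graph of diameter at most two. -/
theorem Phi_lt_of_adj {G H : SimpleGraph V} (hG : ∀ u v : V, u ≠ v → G.edist u v ≤ 2)
    (hGH : G ≤ H) {u w : V} (hnot : ¬ G.Adj u w) (hadj : H.Adj u w) : Phi G u < Phi H u := by
  have hH : ∀ u v : V, u ≠ v → H.edist u v ≤ 2 := fun u v huv =>
    (SimpleGraph.edist_anti hGH).trans (hG u v huv)
  refine Finset.sum_lt_sum (fun v hv => ?_) ⟨w, by simpa using hadj.ne', ?_⟩
  · exact inv_dist_le_inv_dist_of_le hG hGH (Finset.mem_filter.mp hv).2.symm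
  · rw [dist_eq_ite_of_edist_le_two hG hadj.ne, dist_eq_ite_of_edist_le_two hH hadj.ne,
      if_neg hnot, if_pos hadj]
    norm_num

theorem one_le_dist_mul_Phi {G : SimpleGraph V} {u v : V} (hr : G.Reachable u v) (huv : u ≠ v) :
    1 ≤ (G.dist u v : ℝ) * Phi G v := by
  have hpos : (0 : ℝ) < G.dist u v := by exact_mod_cast hr.pos_dist_of_ne huv
  have hle : ((G.dist u v : ℝ))⁻¹ ≤ Phi G v := by
    rw [SimpleGraph.dist_comm]
    exact Finset.single_le_sum (f := fun w => ((G.dist v w : ℝ))⁻¹)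
      (fun w _ => by positivity) (by simpa using huv)
  calc (1 : ℝ) = G.dist u v * (G.dist u v : ℝ)⁻¹ := (mul_inv_cancel₀ hpos.ne').symm
    _ ≤ _ := by gcongr

/-- in a network of diameter at most two with at least three agents,
every agent `k ∉ {i,j}` has unchanged closeness and experiences negative spillover
when the link `⟨ij⟩` is added. -/
theorem stmt_14 (G : SimpleGraph V) (hdiam : ∀ u v : V, u ≠ v → G.edist u v ≤ 2)
    (hcard : 3 ≤ Fintype.card V) (i j : V) (hij : i ≠ j) (hije : ¬ G.Adj i j)
    (p q : ℝ) (hp0 : 0 < p) (hp1 : p < 1) (hq0 : 0 < q) (hq1 : q < 1) :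
    ∀ k : V, k ≠ i → k ≠ j →
      Phi G k = Phi (G ⊔ SimpleGraph.edge i j) k ∧
        gammaRA p q G k > gammaRA p q (G ⊔ SimpleGraph.edge i j) k := by
  intro k hki hkj
  set H := G ⊔ SimpleGraph.edge i j with hHdef
  have hGH : G ≤ H := le_sup_left
  have hH : ∀ u v : V, u ≠ v → H.edist u v ≤ 2 := fun u v huv =>
    (SimpleGraph.edist_anti hGH).trans (hdiam u v huv)
  have hadj : ∀ v, H.Adj k v ↔ G.Adj k v := fun v => by
    simp [hHdef, SimpleGraph.edge_adj, hki, hkj]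
  have hdist : ∀ v, v ≠ k → H.dist k v = G.dist k v := fun v hv => by
    rw [dist_eq_ite_of_edist_le_two hdiam hv.symm, dist_eq_ite_of_edist_le_two hH hv.symm]
    simp only [hadj]
  have hc0 : 0 < p * (1 - q) := mul_pos hp0 (by linarith)
  have hc1 : p * (1 - q) < 1 := by nlinarith
  have hG1 : ∀ v, v ≠ k → 1 ≤ (G.dist k v : ℝ) * Phi G v := fun v hv =>
    one_le_dist_mul_Phi (reachable_of_edist_le_two hdiam k v) hv.symm
  refine ⟨Finset.sum_congr rfl fun v hv => ?_, ?_⟩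
  · rw [hdist v (Finset.mem_filter.mp hv).2]
  · refine sub_lt_sub_left (Finset.prod_lt_prod (fun v hv => ?_) (fun v hv => ?_)
      ⟨i, by simpa using hki.symm, ?_⟩) 1
    · have hvk := (Finset.mem_filter.mp hv).2
      have h1 := hG1 v hvk
      rw [alpha, if_pos (reachable_of_edist_le_two hdiam k v), sub_pos,
        div_lt_one (by linarith)]
      linarith
    · have hvk := (Finset.mem_filter.mp hv).2
      have h1 := hG1 v hvk
      rw [alpha, alpha, if_pos (reachable_of_edist_le_two hdiam k v),
        if_pos (reachable_of_edist_le_two hH k v), hdist v hvk]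
      exact sub_le_sub_left (div_le_div_of_nonneg_left hc0.le (by linarith)
        (mul_le_mul_of_nonneg_left (Phi_mono hdiam hGH v) (Nat.cast_nonneg _))) 1
    · have h1 := hG1 i hki.symm
      have hpos : (0 : ℝ) < G.dist k i := by
        exact_mod_cast (reachable_of_edist_le_two hdiam k i).pos_dist_of_ne hki
      have hlt : Phi G i < Phi H i :=
        Phi_lt_of_adj hdiam hGH hije (by simp [hHdef, SimpleGraph.edge_adj, hij])
      rw [alpha, alpha, if_pos (reachable_of_edist_le_two hdiam k i),
        if_pos (reachable_of_edist_le_two hH k i), hdist i hki.symm]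
      exact sub_lt_sub_left (div_lt_div_of_pos_left hc0 (by linarith)
        (mul_lt_mul_of_pos_left hlt hpos)) 1
end
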